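/- Let G be a labeled weighted graph and Q a rooted query tree with label constraint ψ. For every partial match P that has at least one complete homomorphic match as a successor, the priority of P is defined and equals the minimum of weight(λ) over all complete homomorphic matches λ that are successors of P. In particular, the priority of a complete match equals its weight. -/

import Mathlib

open Finset
open scoped Classical

noncomputable section

/-- A finite rooted tree on node type `A`, given by its root and parent function. -/
structure QueryTree (A : Type) where
  root : A
  parent : A → A
  parent_root : parent root = root
  reaches : ∀ v : A, ∃ n : ℕ, parent^[n] v = root

variable {V L A : Type}

/-- A (complete) homomorphic match of the query tree `Q` (with label constraint `ψ`)
in the labeled graph `G` (with node labeling `φ`). -/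
def IsMatch [Fintype A] [DecidableEq A] (G : SimpleGraph V) (φ : V → L)
    (Q : QueryTree A) (ψ : A → L) (lam : A → V) : Prop :=
  (∀ u : A, φ (lam u) = ψ u) ∧
    ∀ u : A, u ≠ Q.root → G.Adj (lam u) (lam (Q.parent u))

/-- Weight of a complete homomorphic match: sum of the edge weights of the images of the
query edges (each non-root query node contributes its parent edge). -/
def matchWeight [Fintype A] [DecidableEq A] (w : Sym2 V → ℝ) (Q : QueryTree A)
    (lam : A → V) : ℝ :=
  ∑ u ∈ Finset.univ.filter (fun u : A => u ≠ Q.root), w s(lam u, lam (Q.parent u))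

/-- The node set of the subtree `Q_u` of `Q` rooted at `u`: all descendants of `u`. -/
def desc (Q : QueryTree A) (u : A) : Set A := {v | ∃ n : ℕ, Q.parent^[n] v = u}

/-- A subtree match at `(u, c)`: a homomorphic match of the subtree `Q_u` in `G`
mapping `u` to `c` (values outside `Q_u` are unconstrained). -/
def IsSubtreeMatch [Fintype A] [DecidableEq A] (G : SimpleGraph V) (φ : V → L)
    (Q : QueryTree A) (ψ : A → L) (u : A) (c : V) (μ : A → V) : Prop :=
  μ u = c ∧ (∀ v ∈ desc Q u, φ (μ v) = ψ v) ∧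
    ∀ v ∈ desc Q u, v ≠ u → G.Adj (μ v) (μ (Q.parent v))

/-- Weight of a subtree match at `u`: sum of `w` over the images of the edges of `Q_u`. -/
def subtreeWeight [Fintype A] [DecidableEq A] (w : Sym2 V → ℝ) (Q : QueryTree A)
    (u : A) (μ : A → V) : ℝ :=
  ∑ v ∈ Finset.univ.filter (fun v : A => v ∈ desc Q u ∧ v ≠ u),
    w s(μ v, μ (Q.parent v))

/-- There exists a subtree match at `(u, c)`. -/
def SubtreeMatchExists [Fintype A] [DecidableEq A] (G : SimpleGraph V) (φ : V → L)
    (Q : QueryTree A) (ψ : A → L) (u : A) (c : V) : Prop :=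
  ∃ μ : A → V, IsSubtreeMatch G φ Q ψ u c μ

/-- Minimum subtree weight `W(u, c)`: the minimum of the weights of all subtree
matches at `(u, c)` (meaningful whenever such a match exists). -/
def minW [Fintype A] [DecidableEq A] (G : SimpleGraph V) (φ : V → L) (w : Sym2 V → ℝ)
    (Q : QueryTree A) (ψ : A → L) (u : A) (c : V) : ℝ :=
  sInf {x : ℝ | ∃ μ : A → V, IsSubtreeMatch G φ Q ψ u c μ ∧ subtreeWeight w Q u μ = x}

/-- A rooted prefix of `Q`: contains the root and is closed under taking parents. -/
def IsRootedPrefix (Q : QueryTree A) (S : Finset A) : Prop :=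
  Q.root ∈ S ∧ ∀ v ∈ S, Q.parent v ∈ S

/-- Boundary `∂S`: the query nodes outside `S` whose parent lies in `S`. -/
def boundary [Fintype A] [DecidableEq A] (Q : QueryTree A) (S : Finset A) : Finset A :=
  Finset.univ.filter (fun u : A => u ∉ S ∧ Q.parent u ∈ S)

/-- A partial match on the rooted prefix `S`: a homomorphic match of the induced
subtree `Q[S]` in `G` (values outside `S` are unconstrained). -/
def IsPartialMatch [Fintype A] [DecidableEq A] (G : SimpleGraph V) (φ : V → L)
    (Q : QueryTree A) (ψ : A → L) (S : Finset A) (P : A → V) : Prop :=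
  (∀ u ∈ S, φ (P u) = ψ u) ∧ ∀ u ∈ S, u ≠ Q.root → G.Adj (P u) (P (Q.parent u))

/-- The set `{ w({c, c'}) + W(u', c') : c' a neighbor of c, φ(c') = ψ(u'),
a subtree match at (u', c') exists }`. -/
def candSet [Fintype A] [DecidableEq A] (G : SimpleGraph V) (φ : V → L) (w : Sym2 V → ℝ)
    (Q : QueryTree A) (ψ : A → L) (c : V) (u' : A) : Set ℝ :=
  {x : ℝ | ∃ c' : V, G.Adj c c' ∧ φ c' = ψ u' ∧ SubtreeMatchExists G φ Q ψ u' c' ∧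
      x = w s(c, c') + minW G φ w Q ψ u' c'}

/-- Priority of a partial match `P` on the rooted prefix `S`. -/
def priorityVal [Fintype A] [DecidableEq A] (G : SimpleGraph V) (φ : V → L)
    (w : Sym2 V → ℝ) (Q : QueryTree A) (ψ : A → L) (S : Finset A) (P : A → V) : ℝ :=
  (∑ u ∈ S.filter (fun u : A => u ≠ Q.root), w s(P u, P (Q.parent u))) +
    ∑ u' ∈ boundary Q S, sInf (candSet G φ w Q ψ (P (Q.parent u')) u')


theorem mem_boundary [Fintype A] [DecidableEq A] {Q : QueryTree A} {S : Finset A} {u : A} :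
    u ∈ boundary Q S ↔ u ∉ S ∧ Q.parent u ∈ S := by
  simp [boundary]

theorem self_mem_desc (Q : QueryTree A) (u : A) : u ∈ desc Q u := ⟨0, rfl⟩

theorem parent_mem_desc {Q : QueryTree A} {u v : A} (h : v ∈ desc Q u) (hne : v ≠ u) :
    Q.parent v ∈ desc Q u := by
  obtain ⟨n, hn⟩ := h
  cases n with
  | zero => exact absurd hn hne
  | succ n => exact ⟨n, by rwa [Function.iterate_succ_apply] at hn⟩

theorem IsRootedPrefix.iterate_mem {Q : QueryTree A} {S : Finset A} (hS : IsRootedPrefix Q S)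
    {v : A} (hv : v ∈ S) (n : ℕ) : Q.parent^[n] v ∈ S := by
  induction n with
  | zero => exact hv
  | succ n ih => rw [Function.iterate_succ_apply']; exact hS.2 _ ih

theorem IsRootedPrefix.not_mem_of_mem_desc {Q : QueryTree A} {S : Finset A}
    (hS : IsRootedPrefix Q S) {u v : A} (hu : u ∉ S) (hv : v ∈ desc Q u) : v ∉ S := by
  obtain ⟨n, rfl⟩ := hv
  exact fun h => hu (hS.iterate_mem h n)

theorem IsRootedPrefix.exists_boundary_ancestor [Fintype A] [DecidableEq A] {Q : QueryTree A}
    {S : Finset A} (hS : IsRootedPrefix Q S) {v : A} (hv : v ∉ S) :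
    ∃ u ∈ boundary Q S, v ∈ desc Q u := by
  obtain ⟨n, hn⟩ := Q.reaches v
  replace hn : Q.parent^[n] v ∈ S := hn ▸ hS.1
  induction n generalizing v with
  | zero => exact absurd hn hv
  | succ n ih =>
    by_cases hp : Q.parent v ∈ S
    · exact ⟨v, mem_boundary.2 ⟨hv, hp⟩, self_mem_desc Q v⟩
    · obtain ⟨u, hu, k, hk⟩ := ih hp (by rwa [Function.iterate_succ_apply] at hn)
      exact ⟨u, hu, k + 1, by rwa [Function.iterate_succ_apply]⟩

theorem IsRootedPrefix.boundary_ancestor_unique [Fintype A] [DecidableEq A] {Q : QueryTree A}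
    {S : Finset A} (hS : IsRootedPrefix Q S) {u₁ u₂ v : A} (h₁ : u₁ ∈ boundary Q S)
    (h₂ : u₂ ∈ boundary Q S) (hv₁ : v ∈ desc Q u₁) (hv₂ : v ∈ desc Q u₂) : u₁ = u₂ := by
  obtain ⟨n, rfl⟩ := hv₁
  obtain ⟨m, rfl⟩ := hv₂
  have key : ∀ {n m : ℕ}, n < m → Q.parent^[n] v ∈ boundary Q S →
      Q.parent^[m] v ∈ boundary Q S → False := by
    intro n m hnm hn hm
    obtain ⟨k, rfl⟩ := Nat.exists_eq_add_of_lt hnm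
    refine (mem_boundary.1 hm).1 ?_
    rw [show n + k + 1 = k + (n + 1) by omega, Function.iterate_add_apply,
      Function.iterate_succ_apply']
    exact hS.iterate_mem (mem_boundary.1 hn).2 k
  rcases lt_trichotomy n m with h | h | h
  · exact (key h h₁ h₂).elim
  · rw [h]
  · exact (key h h₂ h₁).elim

/-- The edges of `Q` outside a rooted prefix split into the boundary edges and the edges of the
subtrees hanging below them. -/
theorem matchWeight_eq_sum_boundary [Fintype A] [DecidableEq A] (w : Sym2 V → ℝ)
    {Q : QueryTree A} {S : Finset A} (hS : IsRootedPrefix Q S) (lam : A → V) :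
    matchWeight w Q lam =
      (∑ u ∈ S.filter (fun u : A => u ≠ Q.root), w s(lam u, lam (Q.parent u))) +
        ∑ u ∈ boundary Q S, (w s(lam (Q.parent u), lam u) + subtreeWeight w Q u lam) := by
  have hsub (u : A) : w s(lam (Q.parent u), lam u) + subtreeWeight w Q u lam =
      ∑ v ∈ univ.filter (fun v => v ∈ desc Q u),
        w s(lam v, lam (Q.parent v)) := by
    have h : univ.filter (fun v => v ∈ desc Q u) =
        insert u (univ.filter (fun v => v ∈ desc Q u ∧ v ≠ u)) := by
      ext v
      have := self_mem_desc Q u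
      by_cases hv : v = u <;> simp [hv, this]
    rw [h, sum_insert (by simp), subtreeWeight, Sym2.eq_swap]
  have hout : Sᶜ = (boundary Q S).biUnion (fun u => univ.filter (fun v => v ∈ desc Q u)) := by
    ext v
    simp only [mem_compl, mem_biUnion, mem_filter, mem_univ, true_and]
    exact ⟨hS.exists_boundary_ancestor,
      fun ⟨u, hu, hv⟩ => hS.not_mem_of_mem_desc (mem_boundary.1 hu).1 hv⟩
  have hsplit : univ.filter (fun u : A => u ≠ Q.root) =
      S.filter (fun u : A => u ≠ Q.root) ∪ Sᶜ := by
    ext v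
    have : v ∉ S → v ≠ Q.root := fun h h' => h (h' ▸ hS.1)
    simp only [mem_filter, mem_univ, true_and, mem_union, mem_compl]
    tauto
  rw [matchWeight, hsplit, sum_union (disjoint_compl_right.mono_left (filter_subset _ _)), hout,
    sum_biUnion]
  · simp only [hsub]
  · intro u₁ h₁ u₂ h₂ hne
    refine disjoint_left.2 fun v hv₁ hv₂ => hne ?_
    simp only [mem_filter, mem_univ, true_and] at hv₁ hv₂
    exact hS.boundary_ancestor_unique h₁ h₂ hv₁ hv₂

theorem subtreeWeight_congr [Fintype A] [DecidableEq A] (w : Sym2 V → ℝ) {Q : QueryTree A}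
    {u : A} {μ ν : A → V} (h : ∀ v ∈ desc Q u, μ v = ν v) :
    subtreeWeight w Q u μ = subtreeWeight w Q u ν := by
  refine sum_congr rfl fun v hv => ?_
  obtain ⟨hv, hne⟩ := (mem_filter.1 hv).2
  rw [h v hv, h _ (parent_mem_desc hv hne)]

theorem isLeast_minW [Fintype V] [Fintype A] [DecidableEq A] {G : SimpleGraph V} {φ : V → L}
    (w : Sym2 V → ℝ) {Q : QueryTree A} {ψ : A → L} {u : A} {c : V}
    (h : SubtreeMatchExists G φ Q ψ u c) :
    IsLeast {x : ℝ | ∃ μ : A → V, IsSubtreeMatch G φ Q ψ u c μ ∧ subtreeWeight w Q u μ = x}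
      (minW G φ w Q ψ u c) := by
  have hfin : {x : ℝ | ∃ μ : A → V, IsSubtreeMatch G φ Q ψ u c μ ∧
      subtreeWeight w Q u μ = x}.Finite :=
    (Set.finite_range (subtreeWeight w Q u)).subset fun _ ⟨μ, _, hμ⟩ => ⟨μ, hμ⟩
  obtain ⟨μ, hμ⟩ := h
  exact ⟨Set.Nonempty.csInf_mem ⟨_, μ, hμ, rfl⟩ hfin, fun x hx => csInf_le hfin.bddBelow hx⟩

theorem isLeast_candSet [Fintype V] [Fintype A] [DecidableEq A] {G : SimpleGraph V} {φ : V → L}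
    {w : Sym2 V → ℝ} {Q : QueryTree A} {ψ : A → L} {c : V} {u : A}
    (h : (candSet G φ w Q ψ c u).Nonempty) :
    IsLeast (candSet G φ w Q ψ c u) (sInf (candSet G φ w Q ψ c u)) := by
  have hfin : (candSet G φ w Q ψ c u).Finite :=
    (Set.finite_range fun c' => w s(c, c') + minW G φ w Q ψ u c').subset
      fun _ ⟨c', _, _, _, hx⟩ => ⟨c', hx.symm⟩
  exact ⟨h.csInf_mem hfin, fun x hx => csInf_le hfin.bddBelow hx⟩

theorem IsMatch.isSubtreeMatch [Fintype A] [DecidableEq A] {G : SimpleGraph V} {φ : V → L}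
    {Q : QueryTree A} {ψ : A → L} {lam : A → V} (h : IsMatch G φ Q ψ lam) (u : A) :
    IsSubtreeMatch G φ Q ψ u (lam u) lam := by
  refine ⟨rfl, fun v _ => h.1 v, fun v hv hne => h.2 v ?_⟩
  rintro rfl
  obtain ⟨n, hn⟩ := hv
  exact hne (hn ▸ (Function.iterate_fixed Q.parent_root n).symm)

theorem IsMatch.mem_candSet [Fintype A] [DecidableEq A] {G : SimpleGraph V} {φ : V → L}
    (w : Sym2 V → ℝ) {Q : QueryTree A} {ψ : A → L} {lam : A → V} (h : IsMatch G φ Q ψ lam)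
    {u : A} (hu : u ≠ Q.root) :
    w s(lam (Q.parent u), lam u) + minW G φ w Q ψ u (lam u) ∈
      candSet G φ w Q ψ (lam (Q.parent u)) u :=
  ⟨lam u, (h.2 u hu).symm, h.1 u, ⟨lam, h.isSubtreeMatch u⟩, rfl⟩

theorem exists_isSubtreeMatch_eq_sInf_candSet [Fintype V] [Fintype A] [DecidableEq A]
    {G : SimpleGraph V} {φ : V → L} {w : Sym2 V → ℝ} {Q : QueryTree A} {ψ : A → L} {c : V} {u : A}
    (h : (candSet G φ w Q ψ c u).Nonempty) :
    ∃ μ : A → V, IsSubtreeMatch G φ Q ψ u (μ u) μ ∧ G.Adj c (μ u) ∧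
      w s(c, μ u) + subtreeWeight w Q u μ = sInf (candSet G φ w Q ψ c u) := by
  obtain ⟨c', hadj, -, hex, heq⟩ := (isLeast_candSet h).1
  obtain ⟨μ, hμ, hw⟩ := (isLeast_minW w hex).1
  obtain rfl := hμ.1
  exact ⟨μ, hμ, hadj, by rw [heq, hw]⟩

/-- Subtree matches chosen below every boundary node glue with a partial match to a complete
match. -/
theorem IsPartialMatch.exists_isMatch_glue [Fintype A] [DecidableEq A] {G : SimpleGraph V}
    {φ : V → L} {Q : QueryTree A} {ψ : A → L} {S : Finset A} (hS : IsRootedPrefix Q S) {P : A → V}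
    (hP : IsPartialMatch G φ Q ψ S P) (μ : A → A → V)
    (hμ : ∀ u ∈ boundary Q S, IsSubtreeMatch G φ Q ψ u (μ u u) (μ u))
    (hadj : ∀ u ∈ boundary Q S, G.Adj (P (Q.parent u)) (μ u u)) :
    ∃ lam : A → V, IsMatch G φ Q ψ lam ∧ (∀ v ∈ S, lam v = P v) ∧
      ∀ u ∈ boundary Q S, ∀ v ∈ desc Q u, lam v = μ u v := by
  choose b hb hbd using fun v : {v // v ∉ S} => hS.exists_boundary_ancestor v.2
  set lam : A → V := fun v => if h : v ∈ S then P v else μ (b ⟨v, h⟩) v with hlam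
  have hin : ∀ v ∈ S, lam v = P v := fun v hv => by simp [hlam, hv]
  have hout : ∀ u ∈ boundary Q S, ∀ v ∈ desc Q u, lam v = μ u v := by
    intro u hu v hv
    have hvS := hS.not_mem_of_mem_desc (mem_boundary.1 hu).1 hv
    simp only [hlam, hvS, dite_false]
    rw [hS.boundary_ancestor_unique (hb ⟨v, hvS⟩) hu (hbd ⟨v, hvS⟩) hv]
  refine ⟨lam, ⟨fun v => ?_, fun v hroot => ?_⟩, hin, hout⟩
  · by_cases hv : v ∈ S
    · rw [hin v hv]; exact hP.1 v hv
    · obtain ⟨u, hu, hvu⟩ := hS.exists_boundary_ancestor hv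
      rw [hout u hu v hvu]; exact (hμ u hu).2.1 v hvu
  · by_cases hv : v ∈ S
    · rw [hin v hv, hin _ (hS.2 v hv)]; exact hP.2 v hv hroot
    · obtain ⟨u, hu, hvu⟩ := hS.exists_boundary_ancestor hv
      by_cases hne : v = u
      · subst hne
        rw [hout v hu v hvu, hin _ (mem_boundary.1 hu).2]
        exact (hadj v hu).symm
      · rw [hout u hu v hvu, hout u hu _ (parent_mem_desc hvu hne)]
        exact (hμ u hu).2.2 v hvu hne

/-- for every partial match `P` having at least one complete homomorphic
match as a successor, each minimum in the definition of the priority ranges over a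
nonempty set (the priority is defined), and the priority is the minimum of the weights
of all complete homomorphic matches that are successors of `P`; in particular the
priority of a complete match equals its weight. -/
theorem stmt5 [Fintype V] [DecidableEq V] [Fintype A] [DecidableEq A]
    (G : SimpleGraph V) (φ : V → L) (w : Sym2 V → ℝ) (Q : QueryTree A) (ψ : A → L)
    (S : Finset A) (hS : IsRootedPrefix Q S) (P : A → V)
    (hP : IsPartialMatch G φ Q ψ S P)
    (hex : ∃ lam : A → V, IsMatch G φ Q ψ lam ∧ ∀ u ∈ S, lam u = P u) :
    (∀ u' ∈ boundary Q S, (candSet G φ w Q ψ (P (Q.parent u')) u').Nonempty) ∧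
    IsLeast {x : ℝ | ∃ lam : A → V, IsMatch G φ Q ψ lam ∧ (∀ u ∈ S, lam u = P u) ∧
        matchWeight w Q lam = x}
      (priorityVal G φ w Q ψ S P) ∧
    (S = Finset.univ → priorityVal G φ w Q ψ S P = matchWeight w Q P) := by
  obtain ⟨lam₀, hlam₀, hext₀⟩ := hex
  have hroot : ∀ u ∈ boundary Q S, u ≠ Q.root := by
    rintro u hu rfl
    exact (mem_boundary.1 hu).1 hS.1
  have hinner {lam : A → V} (hext : ∀ u ∈ S, lam u = P u) :
      ∑ u ∈ S.filter (fun u : A => u ≠ Q.root), w s(lam u, lam (Q.parent u)) =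
        ∑ u ∈ S.filter (fun u : A => u ≠ Q.root), w s(P u, P (Q.parent u)) := by
    refine sum_congr rfl fun u hu => ?_
    have hu := (mem_filter.1 hu).1
    rw [hext u hu, hext _ (hS.2 u hu)]
  have hne : ∀ u ∈ boundary Q S, (candSet G φ w Q ψ (P (Q.parent u)) u).Nonempty := by
    intro u hu
    rw [← hext₀ _ (mem_boundary.1 hu).2]
    exact ⟨_, hlam₀.mem_candSet w (hroot u hu)⟩
  refine ⟨hne, ⟨?_, ?_⟩, ?_⟩
  · have : Nonempty (A → V) := ⟨lam₀⟩
    choose! μ hμ hadj hval using fun u hu => exists_isSubtreeMatch_eq_sInf_candSet (hne u hu)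
    obtain ⟨lam, hlam, hext, hdesc⟩ := hP.exists_isMatch_glue hS μ hμ hadj
    refine ⟨lam, hlam, hext, ?_⟩
    rw [matchWeight_eq_sum_boundary w hS, hinner hext, priorityVal]
    congr 1
    refine sum_congr rfl fun u hu => ?_
    rw [← hval u hu, subtreeWeight_congr w (hdesc u hu), hext _ (mem_boundary.1 hu).2,
      hdesc u hu u (self_mem_desc Q u)]
  · rintro _ ⟨lam, hlam, hext, rfl⟩
    rw [matchWeight_eq_sum_boundary w hS, hinner hext, priorityVal]
    gcongr with u hu
    have hmin := (isLeast_candSet (hne u hu)).2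
    rw [← hext _ (mem_boundary.1 hu).2] at hmin ⊢
    have hsub := hlam.isSubtreeMatch u
    exact (hmin (hlam.mem_candSet w (hroot u hu))).trans
      (by gcongr; exact (isLeast_minW w ⟨lam, hsub⟩).2 ⟨lam, hsub, rfl⟩)
  · rintro rfl
    have hb : boundary Q (univ : Finset A) = ∅ := by simp [boundary]
    simp [priorityVal, matchWeight, hb]
end
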